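/- The second moment of the squared norm of a random matrix product state equals E_{ψ ∼ μ_{d,n,D}} ⟨ψ|ψ⟩² = 1 + ((dD² − d)/(D²d² − 1))^n; in particular E_{ψ ∼ μ_{d,n,D}} ⟨ψ|ψ⟩² ≤ 1 + d^{−n}. -/

import Mathlib

open MeasureTheory Matrix
open scoped ComplexConjugate

noncomputable section

instance matrixMeasurableSpace {m n : Type*} : MeasurableSpace (Matrix m n ℂ) :=
  MeasurableSpace.pi

/-- The site tensor `A^{(m)}_i = (⟨i| ⊗ 1_D) U (|0⟩ ⊗ 1_D)`. -/
def siteMat (d D : ℕ) [NeZero d] (U : Matrix.unitaryGroup (Fin d × Fin D) ℂ) (i : Fin d) :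
    Matrix (Fin D) (Fin D) ℂ :=
  Matrix.of fun a b => (U : Matrix (Fin d × Fin D) (Fin d × Fin D) ℂ) (i, a) (0, b)

/-- The (unnormalized) matrix product state `ψ`, with periodic boundary conditions:
`ψ(i₁,…,iₙ) = Tr[A^{(1)}_{i₁} ⋯ A^{(n)}_{iₙ}]`. -/
def mps (d D n : ℕ) [NeZero d] (U : Fin n → Matrix.unitaryGroup (Fin d × Fin D) ℂ) :
    (Fin n → Fin d) → ℂ :=
  fun idx => Matrix.trace (((List.finRange n).map fun m => siteMat d D (U m) (idx m)).prod)


theorem perm_ex {ι : Type*} [DecidableEq ι] {a b r s : ι} (hab : a ≠ b) (hrs : r ≠ s) :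
    ∃ σ : Equiv.Perm ι, σ a = r ∧ σ b = s := by
  refine ⟨Equiv.swap (Equiv.swap a r b) s * Equiv.swap a r, ?_, ?_⟩
  · have h : r ≠ Equiv.swap a r b := by
      intro h
      apply hab
      apply (Equiv.swap a r).injective
      simpa using h
    simp [Equiv.swap_apply_of_ne_of_ne h hrs]
  · simp

theorem refl_unitary {ι : Type*} [Fintype ι] [DecidableEq ι] {a b : ι} (hab : a ≠ b) :
    (Matrix.of fun i j => (if i = j then (1:ℂ) else 0) - (2/5) *
        (((if i = a then 1 else 0) + (if i = b then 2 else 0)) *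
          ((if j = a then 1 else 0) + (if j = b then 2 else 0))))
          ∈ Matrix.unitaryGroup ι ℂ := by
  set w : ι → ℂ := fun i => (if i = a then 1 else 0) + (if i = b then 2 else 0) with hw
  have hww : w ⬝ᵥ w = 5 := by
    simp only [dotProduct, hw, mul_add, add_mul, Finset.sum_add_distrib]
    simp [hab, hab.symm]
    norm_num
  have hV : (Matrix.of fun i j => (if i = j then (1:ℂ) else 0) - (2/5) * (w i * w j))
      = 1 - (2/5 : ℂ) • vecMulVec w w := by
    ext i j
    simp [Matrix.one_apply, vecMulVec_apply]
  have hs : star w = w := by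
    ext i
    simp only [hw, Pi.star_apply, RCLike.star_def, map_add, apply_ite conj, map_one, map_zero, map_ofNat]
  change (Matrix.of fun i j => (if i = j then (1:ℂ) else 0) - (2/5) * (w i * w j)) ∈ _
  rw [hV, Matrix.mem_unitaryGroup_iff, Matrix.star_eq_conjTranspose, conjTranspose_sub,
    conjTranspose_smul, conjTranspose_vecMulVec, hs, conjTranspose_one, sub_mul, mul_sub, mul_sub,
    Matrix.smul_mul, Matrix.mul_smul, Matrix.smul_mul, Matrix.mul_smul, vecMulVec_mul_vecMulVec, hww]
  ext i j
  simp [vecMulVec_apply, Complex.conj_ofNat]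
  ring

theorem ite_zero' {p q : Prop} [Decidable p] [Decidable q] (h : ¬ (p ∧ q)) :
    (if p then (1:ℂ) else 0) * (if q then 1 else 0) = 0 := by
  by_cases hp : p <;> simp_all

set_option maxHeartbeats 1000000 in
theorem commutant {ι : Type*} [Fintype ι] [DecidableEq ι] [Nontrivial ι]
    (X : ι → ι → ι → ι → ℂ)
    (hX : ∀ V ∈ Matrix.unitaryGroup ι ℂ, ∀ r r' s s', X r r' s s' =
      ∑ k, ∑ k', ∑ l, ∑ l', V r k * conj (V r' k') * (V s l * conj (V s' l')) * X k k' l l') :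
    ∃ α β : ℂ, ∀ r r' s s', X r r' s s' =
      α * ((if r = r' then 1 else 0) * (if s = s' then 1 else 0)) +
      β * ((if r = s' then 1 else 0) * (if s = r' then 1 else 0)) := by
  obtain ⟨a, b, hab⟩ := exists_pair_ne ι
  have hperm : ∀ (σ : Equiv.Perm ι) r r' s s', X r r' s s' = X (σ r) (σ r') (σ s) (σ s') := by
    intro σ r r' s s'
    have hV : (Matrix.of fun i j => if σ i = j then (1:ℂ) else 0) ∈ Matrix.unitaryGroup ι ℂ := by
      rw [Matrix.mem_unitaryGroup_iff]
      ext i j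
      simp [Matrix.mul_apply, Matrix.one_apply, Matrix.star_apply, eq_comm]
    rw [hX _ hV]
    simp [apply_ite conj, ite_mul, mul_ite, Finset.sum_ite_eq]
  have hdiag : ∀ (t r r' s s' : ι), X r r' s s' =
      (if r = t then Complex.I else 1) * (if r' = t then -Complex.I else 1) *
      ((if s = t then Complex.I else 1) * (if s' = t then -Complex.I else 1)) * X r r' s s' := by
    intro t r r' s s'
    have hV : (Matrix.diagonal fun i => if i = t then Complex.I else 1) ∈ Matrix.unitaryGroup ι ℂ := by
      rw [Matrix.mem_unitaryGroup_iff, Matrix.star_eq_conjTranspose, Matrix.diagonal_conjTranspose,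
        Matrix.diagonal_mul_diagonal, ← Matrix.diagonal_one]
      congr 1
      ext i
      by_cases h : i = t <;> simp [h]
    conv_lhs => rw [hX _ hV]
    simp [Matrix.diagonal_apply, apply_ite conj, ite_mul, mul_ite, Finset.sum_ite_eq]
  have hI : Complex.I ≠ 1 := by intro h; simpa using congrArg Complex.re h
  have hI' : -Complex.I ≠ 1 := by intro h; simpa using congrArg Complex.re h
  have fin : ∀ c x : ℂ, c ≠ 1 → x = c * x → x = 0 := by
    intro c x hc h
    have : (c - 1) * x = 0 := by linear_combination -h
    rcases mul_eq_zero.1 this with h | h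
    · exact absurd (sub_eq_zero.1 h) hc
    · exact h
  have hzero : ∀ r r' s s', ¬ (r = r' ∧ s = s') → ¬ (r = s' ∧ s = r') → X r r' s s' = 0 := by
    intro r r' s s' h1 h2
    have hm : (-1 : ℂ) ≠ 1 := by norm_num
    by_cases h3 : r = r'
    · subst h3
      have h4 : s ≠ s' := fun h => h1 ⟨rfl, h⟩
      have := hdiag s r r s s'
      apply fin _ _ _ this
      by_cases h5 : r = s
      · simp [h5, h4.symm, hI]
      · simp [h5, h4.symm, hI]
    · by_cases h5 : r = s'
      · subst h5
        have h4 : s ≠ r' := fun h => h2 ⟨rfl, h⟩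
        apply fin _ _ _ (hdiag s r r' s r)
        by_cases h5 : r = s
        · simp [h5, h4.symm, hI]
        · simp [h5, h4.symm, hI]
      · apply fin _ _ _ (hdiag r r r' s s')
        by_cases h6 : s = r
        · simp [h6, Ne.symm h3, Ne.symm h5, hm]
        · simp [h6, Ne.symm h3, Ne.symm h5, hI]
  have hrot : X a a a a = X a a b b + X a b b a := by
    have hV := refl_unitary hab
    have h := hX _ hV a a a a
    set v : ι → ℂ := fun k => (if a = k then (1:ℂ) else 0) - (2/5) *
        (((if a = a then 1 else 0) + (if a = b then 2 else 0)) *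
          ((if k = a then 1 else 0) + (if k = b then 2 else 0))) with hv
    have hcv : ∀ k, conj (v k) = v k := by
      intro k
      simp only [hv, map_sub,
        map_mul, map_add, apply_ite conj, map_one, map_zero, map_ofNat, map_div₀]
    have key : ∀ f : ι → ℂ, ∑ k, v k * f k = 3/5 * f a - 4/5 * f b := by
      intro f
      simp only [hv, mul_sub, sub_mul, mul_add, add_mul, Finset.sum_add_distrib, Finset.sum_sub_distrib]
      simp [hab, mul_ite, ite_mul]
      ring
    have h' : X a a a a = ∑ k, v k * ∑ k', v k' * ∑ l, v l * ∑ l', v l' * X k k' l l' := by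
      rw [h]
      simp only [Finset.mul_sum]
      refine Finset.sum_congr rfl fun k _ => Finset.sum_congr rfl fun k' _ =>
        Finset.sum_congr rfl fun l _ => Finset.sum_congr rfl fun l' _ => ?_
      change v k * conj (v k') * (v l * conj (v l')) * _ = _
      rw [hcv, hcv]
      ring
    clear h
    rename' h' => h
    simp only [key] at h
    have e1 : X b b b b = X a a a a := by
      have := hperm (Equiv.swap a b) a a a a; simpa using this.symm
    have e2 : X b b a a = X a a b b := by
      have := hperm (Equiv.swap a b) a a b b; simpa using this.symm
    have e3 : X b a a b = X a b b a := by
      have := hperm (Equiv.swap a b) a b b a; simpa using this.symm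
    have hba := hab.symm
    rw [hzero a a a b, hzero a a b a, hzero a b a a, hzero a b a b, hzero a b b b,
      hzero b a a a, hzero b a b a, hzero b a b b, hzero b b a b, hzero b b b a, e1, e2, e3] at h
    · linear_combination (625/288) * h
    all_goals simp [hab, hba]
  refine ⟨X a a b b, X a b b a, ?_⟩
  intro r r' s s'
  by_cases h1 : r = r' ∧ s = s'
  · obtain ⟨rfl, rfl⟩ := h1
    by_cases h2 : r = s
    · subst h2
      have := hperm (Equiv.swap r a) r r r r
      simp at this
      simp [this, hrot]
    · obtain ⟨σ, e1, e2⟩ := perm_ex hab h2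
      have := hperm σ a a b b
      simp [this, e1, e2, h2]
  · by_cases h2 : r = s' ∧ s = r'
    · obtain ⟨rfl, rfl⟩ := h2
      have h3 : r ≠ s := fun h => h1 ⟨h, h.symm⟩
      obtain ⟨σ, e1, e2⟩ := perm_ex hab h3
      have := hperm σ a b b a
      simp [this, e1, e2, h3]
    · rw [hzero _ _ _ _ h1 h2]
      rw [ite_zero' h1, ite_zero' h2]
      simp

theorem meas_entry {ι : Type*} [Fintype ι] [DecidableEq ι] (r q : ι) :
    Measurable (fun U : Matrix.unitaryGroup ι ℂ => (U : Matrix ι ι ℂ) r q) :=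
  (measurable_pi_apply q).comp ((measurable_pi_apply r).comp measurable_subtype_coe)

theorem meas_mul {ι : Type*} [Fintype ι] [DecidableEq ι] (V : Matrix.unitaryGroup ι ℂ) :
    Measurable (fun U : Matrix.unitaryGroup ι ℂ => V * U) := by
  refine Measurable.subtype_mk ?_
  refine measurable_pi_lambda _ fun r => measurable_pi_lambda _ fun q => ?_
  have : ∀ U : Matrix.unitaryGroup ι ℂ, ((V : Matrix ι ι ℂ) * (U : Matrix ι ι ℂ)) r q =
    ∑ k, (V : Matrix ι ι ℂ) r k * (U : Matrix ι ι ℂ) k q := fun U => Matrix.mul_apply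
  simp only [this]
  exact Finset.measurable_sum _ fun k _ => (meas_entry k q).const_mul _

/-- the quartic monomial -/
def quart {ι : Type*} [Fintype ι] [DecidableEq ι] (q q' p p' r r' s s' : ι)
    (U : Matrix.unitaryGroup ι ℂ) : ℂ :=
  (U : Matrix ι ι ℂ) r q * conj ((U : Matrix ι ι ℂ) r' q') *
    ((U : Matrix ι ι ℂ) s p * conj ((U : Matrix ι ι ℂ) s' p'))

theorem quart_int {ι : Type*} [Fintype ι] [DecidableEq ι]
    (μ : Measure (Matrix.unitaryGroup ι ℂ)) [IsProbabilityMeasure μ] (q q' p p' r r' s s' : ι) :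
    Integrable (quart q q' p p' r r' s s') μ := by
  refine Integrable.of_bound (Measurable.aestronglyMeasurable ?_) 1 ?_
  · have hc : Measurable (fun z : ℂ => conj z) := Complex.continuous_conj.measurable
    exact ((meas_entry r q).mul (hc.comp (meas_entry r' q'))).mul
      ((meas_entry s p).mul (hc.comp (meas_entry s' p')))
  · refine Filter.Eventually.of_forall fun U => ?_
    have h := fun i j => entry_norm_bound_of_unitary U.2 i j
    simp only [quart, norm_mul, RCLike.norm_conj]
    exact mul_le_one₀ (mul_le_one₀ (h _ _) (norm_nonneg _) (h _ _)) (by positivity)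
      (mul_le_one₀ (h _ _) (norm_nonneg _) (h _ _))

theorem quart_inv {ι : Type*} [Fintype ι] [DecidableEq ι]
    (μ : Measure (Matrix.unitaryGroup ι ℂ)) [IsProbabilityMeasure μ]
    (hHaar : ∀ V : Matrix.unitaryGroup ι ℂ, μ.map (fun U => V * U) = μ)
    (q q' p p' : ι) (V : Matrix ι ι ℂ) (hV : V ∈ Matrix.unitaryGroup ι ℂ) (r r' s s' : ι) :
    ∫ U, quart q q' p p' r r' s s' U ∂μ =
      ∑ k, ∑ k', ∑ l, ∑ l', V r k * conj (V r' k') * (V s l * conj (V s' l')) *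
        ∫ U, quart q q' p p' k k' l l' U ∂μ := by
  have h1 : ∫ U, quart q q' p p' r r' s s' U ∂μ =
      ∫ U, quart q q' p p' r r' s s' ((⟨V, hV⟩ : Matrix.unitaryGroup ι ℂ) * U) ∂μ := by
    conv_lhs => rw [← hHaar ⟨V, hV⟩]
    rw [integral_map (meas_mul _).aemeasurable]
    rw [hHaar]
    exact (quart_int μ _ _ _ _ _ _ _ _).aestronglyMeasurable
  have h2 : ∀ U : Matrix.unitaryGroup ι ℂ,
      quart q q' p p' r r' s s' ((⟨V, hV⟩ : Matrix.unitaryGroup ι ℂ) * U) =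
      ∑ k, ∑ k', ∑ l, ∑ l', V r k * conj (V r' k') * (V s l * conj (V s' l')) *
        quart q q' p p' k k' l l' U := by
    intro U
    simp only [quart, Matrix.UnitaryGroup.mul_val, Matrix.mul_apply, map_sum, map_mul]
    simp only [Finset.sum_mul_sum]
    refine Finset.sum_congr rfl fun k _ => ?_
    rw [Finset.sum_comm]
    refine Finset.sum_congr rfl fun k' _ => Finset.sum_congr rfl fun l _ =>
      Finset.sum_congr rfl fun l' _ => ?_
    ring
  have hi := fun k k' l l' => quart_int μ q q' p p' k k' l l'
  rw [h1]
  simp only [h2]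
  rw [integral_finsetSum]
  · refine Finset.sum_congr rfl fun k _ => ?_
    rw [integral_finsetSum]
    · refine Finset.sum_congr rfl fun k' _ => ?_
      rw [integral_finsetSum]
      · refine Finset.sum_congr rfl fun l _ => ?_
        rw [integral_finsetSum]
        · refine Finset.sum_congr rfl fun l' _ => ?_
          rw [integral_const_mul]
        · exact fun _ _ => (hi _ _ _ _).const_mul _
      · exact fun _ _ => integrable_finsetSum _ fun _ _ => (hi _ _ _ _).const_mul _
    · exact fun _ _ => integrable_finsetSum _ fun _ _ => integrable_finsetSum _ fun _ _ =>
        (hi _ _ _ _).const_mul _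
  · exact fun _ _ => integrable_finsetSum _ fun _ _ => integrable_finsetSum _ fun _ _ =>
        integrable_finsetSum _ fun _ _ => (hi _ _ _ _).const_mul _

theorem quart_haar {ι : Type*} [Fintype ι] [DecidableEq ι] [Nontrivial ι]
    (μ : Measure (Matrix.unitaryGroup ι ℂ)) [IsProbabilityMeasure μ]
    (hHaar : ∀ V : Matrix.unitaryGroup ι ℂ, μ.map (fun U => V * U) = μ)
    (q q' p p' : ι) (A B N : ℂ) (hN : N = Fintype.card ι)
    (hA : A = (if q = q' then 1 else 0) * (if p = p' then 1 else 0))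
    (hB : B = (if q = p' then 1 else 0) * (if p = q' then 1 else 0)) (r r' s s' : ι) :
    ∫ U, quart q q' p p' r r' s s' U ∂μ =
      (A - B / N) / (N ^ 2 - 1) * ((if r = r' then 1 else 0) * (if s = s' then 1 else 0)) +
      (B - A / N) / (N ^ 2 - 1) * ((if r = s' then 1 else 0) * (if s = r' then 1 else 0)) := by
  obtain ⟨α, β, h⟩ := commutant (fun r r' s s' => ∫ U, quart q q' p p' r r' s s' U ∂μ)
    (fun V hV r r' s s' => quart_inv μ hHaar q q' p p' V hV r r' s s')
  have orth : ∀ (U : Matrix.unitaryGroup ι ℂ) (i j : ι),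
      ∑ k, (U : Matrix ι ι ℂ) k i * conj ((U : Matrix ι ι ℂ) k j) = if i = j then 1 else 0 := by
    intro U i j
    have := congrFun (congrFun (Matrix.mem_unitaryGroup_iff'.1 U.2) j) i
    rw [Matrix.mul_apply, Matrix.one_apply] at this
    simp only [Matrix.star_apply, RCLike.star_def] at this
    rw [if_congr (eq_comm (a := i)) rfl rfl, ← this]
    exact Finset.sum_congr rfl fun _ _ => mul_comm _ _
  have hi := fun k k' l l' => quart_int μ q q' p p' k k' l l'
  have eA : A = α * N ^ 2 + β * N := by
    have e : ∑ r, ∑ s, ∫ U, quart q q' p p' r r s s U ∂μ = A := by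
      have : ∀ U : Matrix.unitaryGroup ι ℂ, ∑ r, ∑ s, quart q q' p p' r r s s U = A := by
        intro U
        rw [hA, ← orth U, ← orth U, Finset.sum_mul_sum]
        rfl
      calc _ = ∫ U, ∑ r, ∑ s, quart q q' p p' r r s s U ∂μ := by
            rw [integral_finsetSum]
            · refine Finset.sum_congr rfl fun _ _ => ?_
              rw [integral_finsetSum]
              exact fun _ _ => hi _ _ _ _
            · exact fun _ _ => integrable_finsetSum _ fun _ _ => hi _ _ _ _
        _ = A := by simp [this]
    rw [← e]
    simp only [h]
    simp [Finset.sum_add_distrib, hN, mul_ite, eq_comm]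
    ring
  have eB : B = α * N + β * N ^ 2 := by
    have e : ∑ r, ∑ s, ∫ U, quart q q' p p' r s s r U ∂μ = B := by
      have : ∀ U : Matrix.unitaryGroup ι ℂ, ∑ r, ∑ s, quart q q' p p' r s s r U = B := by
        intro U
        rw [hB, ← orth U, ← orth U, Finset.sum_mul_sum]
        refine Finset.sum_congr rfl fun _ _ => Finset.sum_congr rfl fun _ _ => ?_
        simp only [quart]
        ring
      calc _ = ∫ U, ∑ r, ∑ s, quart q q' p p' r s s r U ∂μ := by
            rw [integral_finsetSum]
            · refine Finset.sum_congr rfl fun _ _ => ?_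
              rw [integral_finsetSum]
              exact fun _ _ => hi _ _ _ _
            · exact fun _ _ => integrable_finsetSum _ fun _ _ => hi _ _ _ _
        _ = B := by simp [this]
    rw [← e]
    simp only [h]
    simp [Finset.sum_add_distrib, hN, mul_ite, ite_mul]
    ring
  have hN1 : 1 < Fintype.card ι := Fintype.one_lt_card
  have hN0 : N ≠ 0 := by rw [hN]; exact_mod_cast (by omega)
  have hN2 : N ^ 2 - 1 ≠ 0 := by
    rw [hN, sub_ne_zero]
    exact_mod_cast (Nat.one_lt_pow two_ne_zero hN1).ne'
  have ea : α = (A - B / N) / (N ^ 2 - 1) := by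
    rw [eq_div_iff hN2, eA, eB]; field_simp; ring
  have eb : β = (B - A / N) / (N ^ 2 - 1) := by
    rw [eq_div_iff hN2, eA, eB]; field_simp; ring
  rw [← ea, ← eb]
  exact h r r' s s'


theorem kron_list {α ι κ : Type*} [Fintype ι] [DecidableEq ι] [Fintype κ] [DecidableEq κ]
    (l : List α) (f : α → Matrix ι ι ℂ) (g : α → Matrix κ κ ℂ) :
    (l.map fun x => kroneckerMap (· * ·) (f x) (g x)).prod =
      kroneckerMap (· * ·) (l.map f).prod (l.map g).prod := by
  induction l with
  | nil => simp
  | cons x l ih => simp only [List.map_cons, List.prod_cons, ih, Matrix.mul_kronecker_mul]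

/-- doubled transfer matrix -/
def transB (d D : ℕ) [NeZero d] (U : Matrix.unitaryGroup (Fin d × Fin D) ℂ) :
    Matrix (Fin D × Fin D) (Fin D × Fin D) ℂ :=
  ∑ i, kroneckerMap (· * ·) (siteMat d D U i) ((starRingEnd ℂ).mapMatrix (siteMat d D U i))

/-- quadrupled transfer matrix -/
def transS (d D : ℕ) [NeZero d] (U : Matrix.unitaryGroup (Fin d × Fin D) ℂ) :
    Matrix ((Fin D × Fin D) × (Fin D × Fin D)) ((Fin D × Fin D) × (Fin D × Fin D)) ℂ :=
  kroneckerMap (· * ·) (transB d D U) (transB d D U)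

theorem list_sum {n : ℕ} {β R : Type*} [Fintype β] [Ring R] [Algebra ℂ R] (g : Fin n → β → R) :
    ((List.finRange n).map fun m => ∑ i, g m i).prod =
      ∑ x : Fin n → β, ((List.finRange n).map fun m => g m (x m)).prod := by
  have h := (MultilinearMap.mkPiAlgebraFin ℂ n R).map_sum g
  simpa only [MultilinearMap.mkPiAlgebraFin_apply, List.ofFn_eq_map] using h

theorem norm_mps (d D n : ℕ) [NeZero d] (U : Fin n → Matrix.unitaryGroup (Fin d × Fin D) ℂ) :
    ((∑ x, ‖mps d D n U x‖ ^ 2 : ℝ) : ℂ) =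
      Matrix.trace ((List.finRange n).map fun m => transB d D (U m)).prod := by
  simp only [transB]
  rw [list_sum, Matrix.trace_sum]
  push_cast
  refine Finset.sum_congr rfl fun x _ => ?_
  rw [kron_list, Matrix.trace_kronecker, ← Complex.mul_conj']
  congr 1
  have h := map_list_prod ((starRingEnd ℂ).mapMatrix (m := Fin D))
    ((List.finRange n).map fun m => siteMat d D (U m) (x m))
  rw [List.map_map] at h
  change _ = Matrix.trace (List.map ((starRingEnd ℂ).mapMatrix ∘ fun m => siteMat d D (U m) (x m))
    (List.finRange n)).prod
  rw [← h, mps]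
  exact AddMonoidHom.map_trace (starRingEnd ℂ).toAddMonoidHom _

theorem integral_list {α κ : Type*} [Fintype κ] [DecidableEq κ] {n : ℕ} [MeasurableSpace α]
    (μ : Measure α) [IsProbabilityMeasure μ] (S : α → Matrix κ κ ℂ)
    (hS : ∀ i j, Integrable (fun u => S u i j) μ) :
    ∫ U, Matrix.trace ((List.finRange n).map fun m => S (U m)).prod ∂(Measure.pi fun _ : Fin n => μ)
      = Matrix.trace ((Matrix.of fun i j => ∫ u, S u i j ∂μ) ^ n) := by
  have expand : ∀ W : Fin n → Matrix κ κ ℂ,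
      Matrix.trace ((List.finRange n).map fun m => W m).prod =
      ∑ p : Fin n → κ × κ, (∏ m, W m (p m).1 (p m).2) *
        Matrix.trace ((List.finRange n).map fun m => Matrix.single (p m).1 (p m).2 (1:ℂ)).prod := by
    intro W
    have h1 : ∀ m, W m = ∑ q : κ × κ, W m q.1 q.2 • Matrix.single q.1 q.2 (1:ℂ) := by
      intro m
      rw [Fintype.sum_prod_type]
      conv_lhs => rw [Matrix.matrix_eq_sum_single (W m)]
      simp [Matrix.smul_single]
    have h0 : W = fun m => ∑ q : κ × κ, W m q.1 q.2 • Matrix.single q.1 q.2 (1:ℂ) := funext h1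
    conv_lhs => rw [h0]
    rw [list_sum, Matrix.trace_sum]
    refine Finset.sum_congr rfl fun p _ => ?_
    have h := (MultilinearMap.mkPiAlgebraFin ℂ n (Matrix κ κ ℂ)).map_smul_univ
      (fun m => W m (p m).1 (p m).2) (fun m => Matrix.single (p m).1 (p m).2 (1:ℂ))
    simp only [MultilinearMap.mkPiAlgebraFin_apply, List.ofFn_eq_map] at h
    rw [h, Matrix.trace_smul, smul_eq_mul]
  have h2 := expand (fun _ => Matrix.of fun i j => ∫ u, S u i j ∂μ)
  rw [List.map_const', List.prod_replicate, List.length_finRange] at h2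
  rw [h2]
  simp only [fun U : Fin n → α => expand (fun m => S (U m))]
  rw [integral_finsetSum]
  · refine Finset.sum_congr rfl fun p _ => ?_
    rw [integral_mul_const]
    congr 1
    exact integral_fintype_prod_eq_prod (𝕜 := ℂ) (fun m u => S u (p m).1 (p m).2)
  · intro p _
    refine Integrable.mul_const ?_ _
    exact Integrable.fintype_prod (f := fun m u => S u (p m).1 (p m).2) fun m => hS _ _

theorem transS_apply (d D : ℕ) [NeZero d] (U : Matrix.unitaryGroup (Fin d × Fin D) ℂ)
    (a a' c c' b b' e e' : Fin D) :
    transS d D U ((a, a'), (c, c')) ((b, b'), (e, e')) =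
      ∑ i, ∑ j, quart (0, b) (0, b') (0, e) (0, e') (i, a) (i, a') (j, c) (j, c') U := by
  simp [transS, transB, siteMat, quart, Matrix.sum_apply, Finset.sum_mul_sum]

def matP (D : ℕ) : Matrix ((Fin D × Fin D) × (Fin D × Fin D)) (Fin 2) ℂ :=
  Matrix.of fun x k => if k = 0 then (if x.1.1 = x.1.2 then 1 else 0) * (if x.2.1 = x.2.2 then 1 else 0)
    else (if x.1.1 = x.2.2 then 1 else 0) * (if x.2.1 = x.1.2 then 1 else 0)

def matQ (d D : ℕ) : Matrix (Fin 2) ((Fin D × Fin D) × (Fin D × Fin D)) ℂ :=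
  Matrix.of fun k x => if k = 0 then
      (d:ℂ) ^ 2 * ((matP D x 0 - matP D x 1 / (d * D : ℂ)) / ((d * D : ℂ) ^ 2 - 1))
    else (d:ℂ) * ((matP D x 1 - matP D x 0 / (d * D : ℂ)) / ((d * D : ℂ) ^ 2 - 1))

theorem transS_int (d D : ℕ) [NeZero d]
    (μ : Measure (Matrix.unitaryGroup (Fin d × Fin D) ℂ)) [IsProbabilityMeasure μ]
    (x y : (Fin D × Fin D) × (Fin D × Fin D)) :
    Integrable (fun U => transS d D U x y) μ := by
  obtain ⟨⟨a, a'⟩, ⟨c, c'⟩⟩ := x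
  obtain ⟨⟨b, b'⟩, ⟨e, e'⟩⟩ := y
  simp only [transS_apply]
  exact integrable_finsetSum _ fun _ _ => integrable_finsetSum _ fun _ _ => quart_int μ _ _ _ _ _ _ _ _

theorem transS_exp (d D : ℕ) [NeZero d] (hd : 2 ≤ d) (hD : 2 ≤ D)
    (μ : Measure (Matrix.unitaryGroup (Fin d × Fin D) ℂ)) [IsProbabilityMeasure μ]
    (hHaar : ∀ V : Matrix.unitaryGroup (Fin d × Fin D) ℂ, μ.map (fun U => V * U) = μ) :
    (Matrix.of fun x y => ∫ U, transS d D U x y ∂μ) = matP D * matQ d D := by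
  have : Nontrivial (Fin d × Fin D) := by
    rw [← Fintype.one_lt_card_iff_nontrivial]
    simp
    nlinarith
  ext ⟨⟨a, a'⟩, ⟨c, c'⟩⟩ ⟨⟨b, b'⟩, ⟨e, e'⟩⟩
  rw [Matrix.of_apply]
  simp only [transS_apply]
  rw [integral_finsetSum]
  swap
  · exact fun _ _ => integrable_finsetSum _ fun _ _ => quart_int μ _ _ _ _ _ _ _ _
  have h : ∀ i j : Fin d, ∫ U, quart (0, b) (0, b') (0, e) (0, e') (i, a) (i, a') (j, c) (j, c') U ∂μ
      = (if (a = a') then 1 else 0) * (if c = c' then 1 else 0) *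
        ((matP D ((b, b'), (e, e')) 0 - matP D ((b, b'), (e, e')) 1 / (d * D : ℂ))
          / ((d * D : ℂ) ^ 2 - 1)) +
        (if i = j then 1 else 0) * ((if (a = c') then 1 else 0) * (if c = a' then 1 else 0) *
        ((matP D ((b, b'), (e, e')) 1 - matP D ((b, b'), (e, e')) 0 / (d * D : ℂ))
          / ((d * D : ℂ) ^ 2 - 1))) := by
    intro i j
    rw [quart_haar μ hHaar (0, b) (0, b') (0, e) (0, e') (matP D ((b, b'), (e, e')) 0)
      (matP D ((b, b'), (e, e')) 1) (d * D : ℂ) (by simp) (by simp [matP]) (by simp [matP])]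
    simp only [Prod.mk.injEq, true_and]
    by_cases hij : i = j
    · simp only [hij, true_and, if_true]; ring
    · simp only [hij, Ne.symm hij, false_and, if_false]; ring
  have h2 : ∀ i : Fin d, ∫ U, ∑ j, quart (0, b) (0, b') (0, e) (0, e') (i, a) (i, a') (j, c) (j, c') U ∂μ
      = ∑ j, ∫ U, quart (0, b) (0, b') (0, e) (0, e') (i, a) (i, a') (j, c) (j, c') U ∂μ := by
    intro i
    rw [integral_finsetSum]
    exact fun _ _ => quart_int μ _ _ _ _ _ _ _ _
  simp only [h2, h]
  rw [Matrix.mul_apply, Fin.sum_univ_two]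
  generalize hX : ((matP D ((b, b'), (e, e')) 0 - matP D ((b, b'), (e, e')) 1 / (d * D : ℂ))
          / ((d * D : ℂ) ^ 2 - 1)) = x0
  generalize hY : ((matP D ((b, b'), (e, e')) 1 - matP D ((b, b'), (e, e')) 0 / (d * D : ℂ))
          / ((d * D : ℂ) ^ 2 - 1)) = x1
  have q0 : matQ d D 0 ((b, b'), (e, e')) = (d:ℂ)^2 * x0 := by rw [← hX]; simp [matQ]
  have q1 : matQ d D 1 ((b, b'), (e, e')) = (d:ℂ) * x1 := by rw [← hY]; simp [matQ]
  rw [q0, q1]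
  have p0 : matP D ((a, a'), (c, c')) 0 = (if (a = a') then 1 else 0) * (if c = c' then 1 else 0) := by
    simp [matP]
  have p1 : matP D ((a, a'), (c, c')) 1 = (if (a = c') then 1 else 0) * (if c = a' then 1 else 0) := by
    simp [matP]
  rw [← p0, ← p1]
  simp only [Finset.sum_add_distrib, ← Finset.sum_mul, Finset.sum_ite_eq, Finset.mem_univ, if_true,
    Finset.sum_const, Finset.card_univ, Fintype.card_fin, nsmul_eq_mul]
  ring

theorem matP_sums (D : ℕ) : (∑ x, matP D x 0 * matP D x 0 = (D:ℂ)^2) ∧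
    (∑ x, matP D x 1 * matP D x 0 = (D:ℂ)) ∧ (∑ x, matP D x 0 * matP D x 1 = (D:ℂ)) ∧
    (∑ x, matP D x 1 * matP D x 1 = (D:ℂ)^2) := by
  refine ⟨?_, ?_, ?_, ?_⟩ <;>
  simp [matP, Fintype.sum_prod_type, Finset.sum_ite_eq, pow_two]

theorem trace_pow_two (M : Matrix (Fin 2) (Fin 2) ℂ) (l : ℂ) (ht : M.trace = 1 + l)
    (hdet : M.det = l) (n : ℕ) : (M ^ n).trace = 1 + l ^ n := by
  have hM : M ^ 2 = (1 + l) • M - l • 1 := by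
    rw [Matrix.trace_fin_two] at ht
    rw [Matrix.det_fin_two] at hdet
    ext i j
    fin_cases i <;> fin_cases j <;> simp [pow_two, Matrix.mul_apply, Fin.sum_univ_two]
    · linear_combination M 0 0 * ht - hdet
    · linear_combination M 0 1 * ht
    · linear_combination M 1 0 * ht
    · linear_combination M 1 1 * ht - hdet
  induction n using Nat.twoStepInduction with
  | zero => simp; norm_num
  | one => simpa using ht
  | more n h1 h2 =>
    rw [pow_add, hM, mul_sub, Matrix.trace_sub, Matrix.mul_smul, Matrix.mul_smul, mul_one,
      Matrix.trace_smul, Matrix.trace_smul, ← pow_succ, h1, h2]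
    simp only [smul_eq_mul]
    ring

theorem trace_PQ {κ : Type*} [Fintype κ] [DecidableEq κ] (P : Matrix κ (Fin 2) ℂ)
    (Q : Matrix (Fin 2) κ ℂ) (n : ℕ) : ((P * Q) ^ (n+1)).trace = ((Q * P) ^ (n+1)).trace := by
  have h : ∀ n, (P * Q) ^ (n+1) = P * ((Q * P) ^ n * Q) := by
    intro n
    induction n with
    | zero => simp
    | succ n ih => rw [pow_succ, ih, pow_succ]; simp only [Matrix.mul_assoc]
  rw [h, Matrix.trace_mul_comm, pow_succ]
  simp only [Matrix.mul_assoc]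

theorem lin_sum {κ : Type*} [Fintype κ] (f g h : κ → ℂ) (C N E : ℂ) :
    ∑ x, C * ((f x - g x / N) / E) * h x =
      C * ((∑ x, f x * h x - (∑ x, g x * h x) / N) / E) := by
  rw [Finset.sum_div, ← Finset.sum_sub_distrib, Finset.sum_div, Finset.mul_sum]
  refine Finset.sum_congr rfl fun x _ => ?_
  ring

/-- second moment of the squared norm of a random MPS:
`E ⟨ψ|ψ⟩² = 1 + ((dD² − d)/(D²d² − 1))^n`, and in particular `E ⟨ψ|ψ⟩² ≤ 1 + d^{−n}`.
The `n` site unitaries are drawn i.i.d. from the Haar probability measure on `U(dD)`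
(the unique left-invariant Borel probability measure on the unitary group). -/
theorem second_moment_of_norm
    (d D n : ℕ) [NeZero d] (hd : 2 ≤ d) (hD : 2 ≤ D) (hn : 1 ≤ n)
    (μ : Measure (Matrix.unitaryGroup (Fin d × Fin D) ℂ)) [IsProbabilityMeasure μ]
    (hHaar : ∀ V : Matrix.unitaryGroup (Fin d × Fin D) ℂ, μ.map (fun U => V * U) = μ) :
    (∫ U, (∑ x, ‖mps d D n U x‖ ^ 2) ^ 2 ∂(Measure.pi fun _ : Fin n => μ)
        = 1 + (((d : ℝ) * D ^ 2 - d) / ((D : ℝ) ^ 2 * d ^ 2 - 1)) ^ n) ∧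
    ∫ U, (∑ x, ‖mps d D n U x‖ ^ 2) ^ 2 ∂(Measure.pi fun _ : Fin n => μ)
        ≤ 1 + ((d : ℝ) ^ n)⁻¹ := by
  have key : ∫ U, (∑ x, ‖mps d D n U x‖ ^ 2) ^ 2 ∂(Measure.pi fun _ : Fin n => μ)
        = 1 + (((d : ℝ) * D ^ 2 - d) / ((D : ℝ) ^ 2 * d ^ 2 - 1)) ^ n := by
    have hdc : (d:ℂ) ≠ 0 := by exact_mod_cast (by omega)
    have hDc : (D:ℂ) ≠ 0 := by exact_mod_cast (by omega)
    have hq : (d * D : ℂ) ^ 2 - 1 ≠ 0 := by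
      rw [sub_ne_zero]
      have : 1 < d * D := by nlinarith
      exact_mod_cast (Nat.one_lt_pow two_ne_zero this).ne'
    have hq' : (D : ℂ) ^ 2 * d ^ 2 - 1 ≠ 0 := by
      intro h; apply hq; rw [← h]; ring
    have h1 : ∀ U : Fin n → Matrix.unitaryGroup (Fin d × Fin D) ℂ,
        (((∑ x, ‖mps d D n U x‖ ^ 2) ^ 2 : ℝ) : ℂ) =
          Matrix.trace ((List.finRange n).map fun m => transS d D (U m)).prod := by
      intro U
      simp only [transS]
      rw [kron_list, Matrix.trace_kronecker, ← norm_mps, Complex.ofReal_pow, pow_two]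
    apply Complex.ofReal_injective
    rw [← integral_complex_ofReal]
    simp only [h1]
    rw [integral_list μ (transS d D) (transS_int d D μ), transS_exp d D hd hD μ hHaar]
    obtain ⟨m, rfl⟩ : ∃ m, n = m + 1 := ⟨n - 1, by omega⟩
    obtain ⟨s1, s2, s3, s4⟩ := matP_sums D
    have e00 : (matQ d D * matP D) 0 0 =
        (d:ℂ) ^ 2 * (((D:ℂ) ^ 2 - (D:ℂ) / (d * D : ℂ)) / ((d * D : ℂ) ^ 2 - 1)) := by
      have h := lin_sum (fun x => matP D x 0) (fun x => matP D x 1) (fun x => matP D x 0)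
        ((d:ℂ) ^ 2) (d * D : ℂ) ((d * D : ℂ) ^ 2 - 1)
      simp only [s1, s2, s3, s4] at h
      rw [Matrix.mul_apply, ← h]
      simp [matQ]
    have e01 : (matQ d D * matP D) 0 1 =
        (d:ℂ) ^ 2 * (((D:ℂ) - (D:ℂ) ^ 2 / (d * D : ℂ)) / ((d * D : ℂ) ^ 2 - 1)) := by
      have h := lin_sum (fun x => matP D x 0) (fun x => matP D x 1) (fun x => matP D x 1)
        ((d:ℂ) ^ 2) (d * D : ℂ) ((d * D : ℂ) ^ 2 - 1)
      simp only [s1, s2, s3, s4] at h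
      rw [Matrix.mul_apply, ← h]
      simp [matQ]
    have e10 : (matQ d D * matP D) 1 0 =
        (d:ℂ) * (((D:ℂ) - (D:ℂ) ^ 2 / (d * D : ℂ)) / ((d * D : ℂ) ^ 2 - 1)) := by
      have h := lin_sum (fun x => matP D x 1) (fun x => matP D x 0) (fun x => matP D x 0)
        ((d:ℂ)) (d * D : ℂ) ((d * D : ℂ) ^ 2 - 1)
      simp only [s1, s2, s3, s4] at h
      rw [Matrix.mul_apply, ← h]
      simp [matQ]
    have e11 : (matQ d D * matP D) 1 1 =
        (d:ℂ) * (((D:ℂ) ^ 2 - (D:ℂ) / (d * D : ℂ)) / ((d * D : ℂ) ^ 2 - 1)) := by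
      have h := lin_sum (fun x => matP D x 1) (fun x => matP D x 0) (fun x => matP D x 1)
        ((d:ℂ)) (d * D : ℂ) ((d * D : ℂ) ^ 2 - 1)
      simp only [s1, s2, s3, s4] at h
      rw [Matrix.mul_apply, ← h]
      simp [matQ]
    rw [trace_PQ, trace_pow_two _ (((d : ℂ) * D ^ 2 - d) / ((D : ℂ) ^ 2 * d ^ 2 - 1))]
    · push_cast
      rfl
    · rw [Matrix.trace_fin_two, e00, e11]
      have : (d * D : ℂ) ^ 2 - 1 = (D : ℂ) ^ 2 * d ^ 2 - 1 := by ring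
      rw [this]
      generalize hE : (D : ℂ) ^ 2 * d ^ 2 - 1 = E at hq'
      field_simp
      rw [← hE]
      ring
    · rw [Matrix.det_fin_two, e00, e01, e10, e11]
      have : (d * D : ℂ) ^ 2 - 1 = (D : ℂ) ^ 2 * d ^ 2 - 1 := by ring
      rw [this]
      generalize hE : (D : ℂ) ^ 2 * d ^ 2 - 1 = E at hq'
      field_simp
      rw [← hE]
      ring
  refine ⟨key, ?_⟩
  rw [key]
  have hd' : (2:ℝ) ≤ d := by exact_mod_cast hd
  have hD' : (2:ℝ) ≤ D := by exact_mod_cast hD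
  have hpos : 0 < (D : ℝ) ^ 2 * d ^ 2 - 1 := by nlinarith [mul_le_mul hd' hD' (by norm_num) (by linarith)]
  rw [← inv_pow]
  gcongr
  · apply div_nonneg _ hpos.le
    have : (0:ℝ) ≤ D ^ 2 - 1 := by nlinarith
    nlinarith
  · rw [div_le_iff₀ hpos, inv_mul_eq_div, le_div_iff₀ (by linarith)]
    nlinarith
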